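/- arXiv:2107.08740 — 10 statements merged into one kernel-verified Lean document; each statement's English description precedes it below -/
import Mathlib

section
/- Let M be a simple-𝔊-torsion-free R-module. Then M is a prime R-module; moreover, every nonzero R-endomorphism of M is injective. -/
section Defs

variable (R : Type*) [CommRing R]

/-- A Gabriel topology on the commutative ring `R`: contains `R`, is upward closed,
is closed under colon by elements, and satisfies the Gabriel axiom. -/
def IsGabrielTopology (G : Set (Ideal R)) : Prop :=
  ⊤ ∈ G ∧
  (∀ a b : Ideal R, a ∈ G → a ≤ b → b ∈ G) ∧
  (∀ a ∈ G, ∀ r : R, Submodule.colon a (Ideal.span {r}) ∈ G) ∧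
  (∀ b : Ideal R, (∃ a ∈ G, ∀ x ∈ a, Submodule.colon b (Ideal.span {x}) ∈ G) → b ∈ G)

/-- `𝔊*`: the maximal elements of `Spec R \ 𝔊`. -/
def GStar (G : Set (Ideal R)) : Set (Ideal R) :=
  {p | p.IsPrime ∧ p ∉ G ∧ ∀ q : Ideal R, q.IsPrime → p < q → q ∈ G}

variable (M : Type*) [AddCommGroup M] [Module R M]

/-- `M` is `𝔊`-torsion-free: no nonzero element is annihilated by an ideal of `𝔊`. -/
def IsGTorsionFree (G : Set (Ideal R)) : Prop :=
  ∀ a ∈ G, ∀ x : M, (∀ r ∈ a, r • x = 0) → x = 0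

/-- `M` is `𝔊`-torsion: every element is annihilated by some ideal of `𝔊`. -/
def IsGTorsion (G : Set (Ideal R)) : Prop :=
  ∀ x : M, ∃ a ∈ G, ∀ r ∈ a, r • x = 0

/-- `M` is simple-`𝔊`-torsion-free. -/
def IsSimpleGTorsionFree (G : Set (Ideal R)) : Prop :=
  IsGTorsionFree R M G ∧ (∃ x : M, x ≠ 0) ∧
    ∀ U : Submodule R M, U ≠ ⊥ → U ≠ ⊤ → ¬ IsGTorsionFree R (M ⧸ U) G

/-- `M` is `𝔊`-divisible: `𝔞M = M` for all `𝔞 ∈ 𝔊`. -/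
def IsGDivisible (G : Set (Ideal R)) : Prop :=
  ∀ a ∈ G, a • (⊤ : Submodule R M) = ⊤

/-- `M` is simple-`𝔊`-divisible. -/
def IsSimpleGDivisible (G : Set (Ideal R)) : Prop :=
  IsGDivisible R M G ∧ (∃ x : M, x ≠ 0) ∧
    ∀ V : Submodule R M, V ≠ ⊥ → V ≠ ⊤ → ¬ (∀ a ∈ G, a • V = V)

/-- `M` is a prime module. -/
def IsPrimeModule : Prop :=
  (∃ x : M, x ≠ 0) ∧ ∀ (r : R) (x : M), r • x = 0 → x = 0 ∨ ∀ y : M, r • y = 0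

/-- `M` is uniform: two nonzero submodules intersect nontrivially. -/
def IsUniformModule : Prop :=
  ∀ U V : Submodule R M, U ≠ ⊥ → V ≠ ⊥ → U ⊓ V ≠ ⊥

/-- `M` is supplemented. -/
def IsSupplementedModule : Prop :=
  ∀ U : Submodule R M, ∃ V : Submodule R M, U ⊔ V = ⊤ ∧
    ∀ W : Submodule R M, W ≤ V → U ⊔ W = ⊤ → W = V

/-- torsion-free (over a domain, element form). -/
def IsTorsionFreeMod : Prop :=
  ∀ d : R, d ≠ 0 → Function.Injective (fun x : M => d • x)

def IsSimpleTorsionFreeMod : Prop :=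
  IsTorsionFreeMod R M ∧ (∃ x : M, x ≠ 0) ∧
    ∀ U : Submodule R M, U ≠ ⊥ → U ≠ ⊤ → ¬ IsTorsionFreeMod R (M ⧸ U)

/-- divisible (over a domain, element form). -/
def IsDivisibleMod : Prop :=
  ∀ d : R, d ≠ 0 → Function.Surjective (fun x : M => d • x)

def IsSimpleDivisibleMod : Prop :=
  IsDivisibleMod R M ∧ (∃ x : M, x ≠ 0) ∧
    ∀ V : Submodule R M, V ≠ ⊥ → V ≠ ⊤ →
      ¬ (∀ d : R, d ≠ 0 → ∀ x ∈ V, ∃ y ∈ V, d • y = x)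

end Defs

/-- The residue field `κ(p) = R_p / p R_p`, as an `R`-module. -/
abbrev kappa (R : Type*) [CommRing R] (p : Ideal R) [p.IsPrime] : Type _ :=
  IsLocalRing.ResidueField (Localization.AtPrime p)


/-- The quotient by the kernel of a linear map with `𝔊`-torsion-free codomain is
`𝔊`-torsion-free. -/
theorem IsGTorsionFree.quotient_ker {R M N : Type*} [CommRing R] [AddCommGroup M] [Module R M]
    [AddCommGroup N] [Module R N] {G : Set (Ideal R)} (hN : IsGTorsionFree R N G)
    (f : M →ₗ[R] N) : IsGTorsionFree R (M ⧸ LinearMap.ker f) G := by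
  intro a ha x hx
  obtain ⟨m, rfl⟩ := Submodule.mkQ_surjective _ x
  rw [Submodule.mkQ_apply, Submodule.Quotient.mk_eq_zero, LinearMap.mem_ker]
  refine hN a ha (f m) fun r hr => ?_
  have h := hx r hr
  rwa [← map_smul, Submodule.mkQ_apply, Submodule.Quotient.mk_eq_zero, LinearMap.mem_ker,
    map_smul] at h

/-- A nonzero linear map from a simple-`𝔊`-torsion-free module to a `𝔊`-torsion-free module
is injective. -/
theorem IsSimpleGTorsionFree.injective {R M N : Type*} [CommRing R] [AddCommGroup M] [Module R M]
    [AddCommGroup N] [Module R N] {G : Set (Ideal R)} (hM : IsSimpleGTorsionFree R M G)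
    (hN : IsGTorsionFree R N G) {f : M →ₗ[R] N} (hf : f ≠ 0) : Function.Injective f := by
  rw [← LinearMap.ker_eq_bot]
  by_contra h
  exact hM.2.2 _ h (fun htop => hf (LinearMap.ker_eq_top.mp htop)) (hN.quotient_ker f)

/-- A simple-`𝔊`-torsion-free module is prime. -/
theorem IsSimpleGTorsionFree.isPrimeModule {R M : Type*} [CommRing R] [AddCommGroup M]
    [Module R M] {G : Set (Ideal R)} (hM : IsSimpleGTorsionFree R M G) : IsPrimeModule R M := by
  refine ⟨hM.2.1, fun r x hrx => ?_⟩
  by_cases hr : LinearMap.lsmul R M r = 0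
  · exact Or.inr fun y => LinearMap.congr_fun hr y
  · exact Or.inl ((map_eq_zero_iff _ (hM.injective hM.1 hr)).mp hrx)

theorem stmt0 (R : Type*) [CommRing R] [IsNoetherianRing R] [IsLocalRing R]
    (G : Set (Ideal R)) (hG : IsGabrielTopology R G)
    (M : Type*) [AddCommGroup M] [Module R M]
    (hM : IsSimpleGTorsionFree R M G) :
    IsPrimeModule R M ∧ ∀ f : M →ₗ[R] M, f ≠ 0 → Function.Injective f :=
  ⟨hM.isPrimeModule, fun _ hf => hM.injective hM.1 hf⟩
end

section
/- Let M be a simple-𝔊-torsion-free R-module. Then M is uniform; in fact, for every nonzero submodule U of M the quotient M/U is 𝔊-torsion. -/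
section GabrielTopology

variable {R : Type*} [CommRing R] {G : Set (Ideal R)}

namespace IsGabrielTopology

/-- An elementwise form of the Gabriel axiom. -/
theorem mem_of_forall_exists (hG : IsGabrielTopology R G) {a b : Ideal R} (ha : a ∈ G)
    (h : ∀ x ∈ a, ∃ c ∈ G, ∀ s ∈ c, s * x ∈ b) : b ∈ G := by
  refine hG.2.2.2 b ⟨a, ha, fun x hx => ?_⟩
  obtain ⟨c, hc, hcb⟩ := h x hx
  refine hG.2.1 c _ hc fun s hs => Submodule.mem_colon.2 fun y hy => ?_
  obtain ⟨t, rfl⟩ := Ideal.mem_span_singleton'.1 hy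
  rw [smul_eq_mul, mul_left_comm]
  exact b.mul_mem_left t (hcb s hs)

theorem inf_mem (hG : IsGabrielTopology R G) {a b : Ideal R} (ha : a ∈ G) (hb : b ∈ G) :
    a ⊓ b ∈ G :=
  hG.mem_of_forall_exists ha fun x hx =>
    ⟨b, hb, fun s hs => ⟨a.mul_mem_left s hx, b.mul_mem_right x hs⟩⟩

variable {M : Type*} [AddCommGroup M] [Module R M]

/-- The `𝔊`-closure of `U`: the elements whose classes in `M ⧸ U` are `𝔊`-torsion. -/
def closure (hG : IsGabrielTopology R G) (U : Submodule R M) : Submodule R M where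
  carrier := {x | ∃ a ∈ G, ∀ r ∈ a, r • x ∈ U}
  zero_mem' := ⟨⊤, hG.1, fun r _ => by simp⟩
  add_mem' := by
    rintro x y ⟨a, ha, hax⟩ ⟨b, hb, hby⟩
    refine ⟨a ⊓ b, hG.inf_mem ha hb, fun r hr => ?_⟩
    rw [smul_add]
    exact U.add_mem (hax r hr.1) (hby r hr.2)
  smul_mem' := by
    rintro t x ⟨a, ha, hax⟩
    refine ⟨a, ha, fun r hr => ?_⟩
    rw [smul_comm]
    exact U.smul_mem t (hax r hr)

theorem mem_closure (hG : IsGabrielTopology R G) {U : Submodule R M} {x : M} :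
    x ∈ hG.closure U ↔ ∃ a ∈ G, ∀ r ∈ a, r • x ∈ U :=
  Iff.rfl

theorem le_closure (hG : IsGabrielTopology R G) (U : Submodule R M) : U ≤ hG.closure U :=
  fun _ hx => ⟨⊤, hG.1, fun r _ => U.smul_mem r hx⟩

theorem isGTorsionFree_quotient_closure (hG : IsGabrielTopology R G) (U : Submodule R M) :
    IsGTorsionFree R (M ⧸ hG.closure U) G := by
  intro a ha x hx
  obtain ⟨x, rfl⟩ := Submodule.Quotient.mk_surjective _ x
  refine (Submodule.Quotient.mk_eq_zero _).2
    ⟨U.comap (LinearMap.toSpanSingleton R M x), hG.mem_of_forall_exists ha fun r hr => ?_,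
      fun r hr => by simpa using hr⟩
  have hrx : r • x ∈ hG.closure U := (Submodule.Quotient.mk_eq_zero _).1 (hx r hr)
  obtain ⟨c, hc, hcU⟩ := hG.mem_closure.1 hrx
  exact ⟨c, hc, fun s hs => by simpa [mul_smul] using hcU s hs⟩

end IsGabrielTopology

theorem IsSimpleGTorsionFree.closure_eq_top {M : Type*} [AddCommGroup M] [Module R M]
    (hM : IsSimpleGTorsionFree R M G) (hG : IsGabrielTopology R G) {U : Submodule R M}
    (hU : U ≠ ⊥) : hG.closure U = ⊤ := by
  by_contra h
  exact hM.2.2 _ (ne_bot_of_le_ne_bot hU (hG.le_closure U)) h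
    (hG.isGTorsionFree_quotient_closure U)

end GabrielTopology

theorem stmt1 (R : Type*) [CommRing R] [IsNoetherianRing R] [IsLocalRing R]
    (G : Set (Ideal R)) (hG : IsGabrielTopology R G)
    (M : Type*) [AddCommGroup M] [Module R M]
    (hM : IsSimpleGTorsionFree R M G) :
    IsUniformModule R M ∧ ∀ U : Submodule R M, U ≠ ⊥ → IsGTorsion R (M ⧸ U) G := by
  have key : ∀ U : Submodule R M, U ≠ ⊥ → ∀ x : M, ∃ a ∈ G, ∀ r ∈ a, r • x ∈ U :=
    fun U hU x => hG.mem_closure.1 (hM.closure_eq_top hG hU ▸ Submodule.mem_top)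
  refine ⟨fun U V hU hV hUV => ?_, fun U hU x => ?_⟩
  · obtain ⟨v, hvV, hv⟩ := V.exists_mem_ne_zero_of_ne_bot hV
    obtain ⟨a, ha, hav⟩ := key U hU v
    refine hv (hM.1 a ha v fun r hr => ?_)
    rw [← Submodule.mem_bot R, ← hUV]
    exact ⟨hav r hr, V.smul_mem r hvV⟩
  · obtain ⟨x, rfl⟩ := Submodule.Quotient.mk_surjective _ x
    obtain ⟨a, ha, hax⟩ := key U hU x
    exact ⟨a, ha, fun r hr => (Submodule.Quotient.mk_eq_zero U).2 (hax r hr)⟩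
end

section
/- Let p ∈ 𝔊* and let N be an R-module with pN = 0. Then N is 𝔊-torsion-free if and only if N is torsion-free as a module over the integral domain R/p (i.e. every nonzero element of R/p acts injectively on N). -/
/-- In a Noetherian ring, an ideal lies in a Gabriel topology as soon as all primes above it do. -/
theorem IsGabrielTopology.mem_of_forall_isPrime_mem {R : Type*} [CommRing R] [IsNoetherianRing R]
    {G : Set (Ideal R)} (hG : IsGabrielTopology R G) (I : Ideal R)
    (hI : ∀ q : Ideal R, q.IsPrime → I ≤ q → q ∈ G) : I ∈ G := by
  obtain ⟨htop, hup, -, hgab⟩ := hG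
  induction I using WellFoundedGT.induction with
  | ind I ih =>
    have hmem : ∀ J : Ideal R, I < J → J ∈ G := fun J hJ =>
      ih J hJ fun q hq hJq => hI q hq (hJ.le.trans hJq)
    by_cases hIt : I = ⊤
    · exact hIt ▸ htop
    by_cases hprime : I.IsPrime
    · exact hI I hprime le_rfl
    obtain ⟨x, y, hxy, hx, hy⟩ : ∃ x y, x * y ∈ I ∧ x ∉ I ∧ y ∉ I := by
      by_contra! h
      exact hprime ⟨hIt, fun {x y} hxy => or_iff_not_imp_left.2 (h x y hxy)⟩
    have hlt : ∀ z ∉ I, I ⊔ Ideal.span {z} ∈ G := fun z hz =>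
      hmem _ (left_lt_sup.2 fun hle => hz (hle (Ideal.mem_span_singleton_self z)))
    refine hgab I ⟨_, hlt x hx, fun z hz => hup _ _ (hlt y hy) ?_⟩
    have hyz : y * z ∈ I := by
      obtain ⟨i, hi, w, hw, rfl⟩ := Submodule.mem_sup.1 hz
      obtain ⟨c, rfl⟩ := Ideal.mem_span_singleton'.1 hw
      have : y * (i + c * x) = y * i + c * (x * y) := by ring
      rw [this]
      exact I.add_mem (I.mul_mem_left _ hi) (I.mul_mem_left _ hxy)
    have hcolon : ∀ r, r * z ∈ I → r ∈ Submodule.colon I (Ideal.span {z}) := by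
      intro r hr
      refine Submodule.mem_colon.2 fun s hs => ?_
      obtain ⟨c, rfl⟩ := Ideal.mem_span_singleton'.1 hs
      rw [smul_eq_mul, mul_left_comm]
      exact I.mul_mem_left c hr
    refine sup_le (fun r hr => hcolon r (I.mul_mem_right z hr)) ?_
    exact (Ideal.span_singleton_le_iff_mem _).2 (hcolon y hyz)

theorem stmt3 (R : Type*) [CommRing R] [IsNoetherianRing R] [IsLocalRing R]
    (G : Set (Ideal R)) (hG : IsGabrielTopology R G)
    (p : Ideal R) (hp : p ∈ GStar R G)
    (N : Type*) [AddCommGroup N] [Module R N]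
    (hpN : Module.IsTorsionBySet R N (p : Set R)) :
    IsGTorsionFree R N G ↔ @IsTorsionFreeMod (R ⧸ p) _ N _ hpN.module := by
  obtain ⟨-, hpG, hmax⟩ := hp
  let := hpN.module
  constructor
  · intro h d hd
    obtain ⟨d, rfl⟩ := Ideal.Quotient.mk_surjective d
    have hdp : d ∉ p := fun hmem => hd (Ideal.Quotient.eq_zero_iff_mem.2 hmem)
    have hmemG : p ⊔ Ideal.span {d} ∈ G := by
      refine hG.mem_of_forall_isPrime_mem _ fun q hq hle => hmax q hq ?_
      refine lt_of_le_of_ne (le_sup_left.trans hle) ?_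
      rintro rfl
      exact hdp (hle (Ideal.mem_sup_right (Ideal.mem_span_singleton_self d)))
    intro x y hxy
    have hdxy : d • (x - y) = 0 := by
      rw [smul_sub, sub_eq_zero]
      exact hxy
    refine sub_eq_zero.1 (h _ hmemG (x - y) fun r hr => ?_)
    obtain ⟨i, hi, w, hw, rfl⟩ := Submodule.mem_sup.1 hr
    obtain ⟨c, rfl⟩ := Ideal.mem_span_singleton'.1 hw
    rw [add_smul, mul_smul, hdxy, smul_zero, add_zero]
    exact @hpN (x - y) ⟨i, hi⟩
  · intro h a ha x hx
    obtain ⟨r, hra, hrp⟩ := Set.not_subset.1 fun hle : (a : Set R) ⊆ p => hpG (hG.2.1 a p ha hle)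
    refine h (Ideal.Quotient.mk p r) (fun h0 => hrp (Ideal.Quotient.eq_zero_iff_mem.1 h0)) ?_
    change r • x = r • (0 : N)
    rw [hx r hra, smul_zero]
end

section
/- Let p ∈ 𝔊* and let N be an R-module with pN = 0. Then N is 𝔊-divisible if and only if N is divisible as a module over the integral domain R/p (i.e. every nonzero element of R/p acts surjectively on N). -/
/-- A Gabriel topology on a Noetherian ring contains every ideal all of whose prime
overideals it contains. -/
theorem IsGabrielTopology.mem_of_forall_isPrime {R : Type*} [CommRing R] [IsNoetherianRing R]
    {G : Set (Ideal R)} (hG : IsGabrielTopology R G) (I : Ideal R)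
    (h : ∀ q : Ideal R, q.IsPrime → I ≤ q → q ∈ G) : I ∈ G := by
  obtain ⟨htop, hup, -, hgab⟩ := hG
  induction I using IsNoetherian.induction with
  | hgt I ih =>
    by_contra hI
    have key : ∀ x ∉ I, I ⊔ Ideal.span {x} ∈ G := fun x hx ↦
      ih _ (left_lt_sup.mpr (by simpa [Ideal.span_singleton_le_iff_mem] using hx))
        fun q hq hle ↦ h q hq (le_sup_left.trans hle)
    refine hI (h I (Ideal.isPrime_iff.mpr ⟨fun e ↦ hI (e ▸ htop), fun {x y} hxy ↦ ?_⟩) le_rfl)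
    by_contra! hne
    refine hI (hgab I ⟨_, key x hne.1, fun z hz ↦ hup _ _ (key y hne.2) ?_⟩)
    have hmul : (I ⊔ Ideal.span {y}) * (I ⊔ Ideal.span {x}) ≤ I := by
      rw [Ideal.sup_mul, Ideal.mul_sup (Ideal.span {y}), Ideal.span_singleton_mul_span_singleton]
      refine sup_le Ideal.mul_le_left (sup_le Ideal.mul_le_right ?_)
      rwa [Ideal.span_singleton_le_iff_mem, mul_comm]
    intro w hw
    refine Submodule.mem_colon.mpr fun t ht ↦ hmul (Ideal.mul_mem_mul hw ?_)
    exact (Ideal.span_singleton_le_iff_mem _).mpr hz ht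

theorem stmt4 (R : Type*) [CommRing R] [IsNoetherianRing R] [IsLocalRing R]
    (G : Set (Ideal R)) (hG : IsGabrielTopology R G)
    (p : Ideal R) (hp : p ∈ GStar R G)
    (N : Type*) [AddCommGroup N] [Module R N]
    (hpN : Module.IsTorsionBySet R N (p : Set R)) :
    IsGDivisible R N G ↔ @IsDivisibleMod (R ⧸ p) _ N _ hpN.module := by
  obtain ⟨-, hpG, hmax⟩ := hp
  let := hpN.module
  constructor
  · intro hdiv d hd y
    obtain ⟨r, rfl⟩ := Ideal.Quotient.mk_surjective d
    have hr : r ∉ p := fun h ↦ hd (Ideal.Quotient.eq_zero_iff_mem.mpr h)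
    have hlt : p < p ⊔ Ideal.span {r} :=
      left_lt_sup.mpr (by simpa [Ideal.span_singleton_le_iff_mem] using hr)
    have hmem : p ⊔ Ideal.span {r} ∈ G :=
      hG.mem_of_forall_isPrime _ fun q hq hle ↦ hmax q hq (hlt.trans_le hle)
    have hle : (p ⊔ Ideal.span {r}) • (⊤ : Submodule R N) ≤
        LinearMap.range (LinearMap.lsmul R N r) := by
      rw [Submodule.sup_smul]
      refine sup_le (Submodule.smul_le.mpr fun a ha n _ ↦ ?_)
        (Submodule.smul_le.mpr fun a ha n _ ↦ ?_)
      · exact (@hpN n ⟨a, ha⟩ : a • n = 0) ▸ zero_mem _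
      · obtain ⟨c, rfl⟩ := Ideal.mem_span_singleton'.mp ha
        exact ⟨c • n, by simp [smul_smul, mul_comm]⟩
    rw [hdiv _ hmem] at hle
    obtain ⟨x, hx⟩ := hle (Submodule.mem_top (x := y))
    exact ⟨x, hx⟩
  · intro hdiv a ha
    obtain ⟨r, hra, hrp⟩ := SetLike.not_le_iff_exists.mp fun hle ↦ hpG (hG.2.1 a p ha hle)
    refine eq_top_iff.mpr fun y _ ↦ ?_
    obtain ⟨x, rfl⟩ := hdiv (Ideal.Quotient.mk p r)
      (fun h ↦ hrp (Ideal.Quotient.eq_zero_iff_mem.mp h)) y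
    exact Submodule.smul_mem_smul hra Submodule.mem_top
end

section
/- Let p be a prime ideal of R and κ(p) = R_p/pR_p. The following are equivalent: (i) κ(p) is simple-𝔊-torsion-free as an R-module; (ii) κ(p) is simple-𝔊-divisible as an R-module; (iii) p ∈ 𝔊*. -/
theorem IsGabrielTopology.exists_mem_notMem {R : Type*} [CommRing R] {G : Set (Ideal R)}
    (hG : IsGabrielTopology R G) {q : Ideal R} (hq : q ∉ G) {a : Ideal R} (ha : a ∈ G) : ∃ r ∈ a, r ∉ q :=
  SetLike.not_le_iff_exists.1 fun h => hq (hG.2.1 _ _ ha h)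

theorem IsGabrielTopology.mul_mem {R : Type*} [CommRing R] {G : Set (Ideal R)}
    (hG : IsGabrielTopology R G) {a b : Ideal R} (ha : a ∈ G) (hb : b ∈ G) : a * b ∈ G := by
  obtain ⟨-, hup, -, hgab⟩ := hG
  refine hgab _ ⟨a, ha, fun x hx => hup b _ hb fun y hy => ?_⟩
  rw [Submodule.mem_colon]
  intro z hz
  obtain ⟨c, rfl⟩ := Ideal.mem_span_singleton'.1 hz
  rw [smul_eq_mul, mul_comm y]
  exact Ideal.mul_mem_mul (Ideal.mul_mem_left _ _ hx) hy

/-- Over a Noetherian ring, an ideal belongs to a Gabriel topology as soon as it is strictly above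
some `p` all of whose strictly larger primes belong to the topology. -/
theorem IsGabrielTopology.mem_of_forall_prime_lt {R : Type*} [CommRing R] [IsNoetherianRing R]
    {G : Set (Ideal R)} (hG : IsGabrielTopology R G) {p : Ideal R}
    (hp : ∀ q : Ideal R, q.IsPrime → p < q → q ∈ G) (b : Ideal R) : p < b → b ∈ G := by
  induction b using IsNoetherian.induction with
  | hgt b ih =>
    intro hb
    by_contra hbG
    refine hbG (hp b ⟨fun h => hbG (h ▸ hG.1), fun {x y} hxy => ?_⟩ hb)
    by_contra! hcon
    have key : ∀ z ∉ b, b ⊔ Ideal.span {z} ∈ G := fun z hz => by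
      have hlt : b < b ⊔ Ideal.span {z} := left_lt_sup.2 <| by
        rwa [Ideal.span_singleton_le_iff_mem]
      exact ih _ hlt (hb.trans hlt)
    refine hbG (hG.2.1 _ _ (hG.mul_mem (key x hcon.1) (key y hcon.2)) ?_)
    rw [Ideal.sup_mul, Ideal.mul_sup, Ideal.mul_sup, Ideal.span_singleton_mul_span_singleton]
    refine sup_le (sup_le Ideal.mul_le_right Ideal.mul_le_left) (sup_le Ideal.mul_le_right ?_)
    rwa [Ideal.span_singleton_le_iff_mem]

theorem Ideal.exists_smul_residueField_eq_algebraMap {R : Type*} [CommRing R] (p : Ideal R)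
    [p.IsPrime] (x : p.ResidueField) :
    ∃ a : R, ∃ b ∉ p, b • x = algebraMap R p.ResidueField a := by
  obtain ⟨a, b, hb, rfl⟩ := IsFractionRing.div_surjective (A := R ⧸ p) x
  obtain ⟨a, rfl⟩ := Ideal.Quotient.mk_surjective a
  obtain ⟨b, rfl⟩ := Ideal.Quotient.mk_surjective b
  have hbp : b ∉ p := fun h => nonZeroDivisors.ne_zero hb (Ideal.Quotient.eq_zero_iff_mem.2 h)
  have hb0 : algebraMap R p.ResidueField b ≠ 0 := by
    rwa [Ne, Ideal.algebraMap_residueField_eq_zero]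
  refine ⟨a, b, hbp, ?_⟩
  change b • (algebraMap R p.ResidueField a / algebraMap R p.ResidueField b) = _
  rw [Algebra.smul_def, mul_div_cancel₀ _ hb0]

theorem Ideal.smul_residueField_eq_zero {R : Type*} [CommRing R] {p : Ideal R}
    [p.IsPrime] {r : R} {x : p.ResidueField} : r • x = 0 ↔ r ∈ p ∨ x = 0 := by
  rw [Algebra.smul_def, mul_eq_zero, Ideal.algebraMap_residueField_eq_zero]

theorem Ideal.exists_smul_residueField_eq {R : Type*} [CommRing R] {p : Ideal R}
    [p.IsPrime] {r : R} (hr : r ∉ p) (x : p.ResidueField) : ∃ y, r • y = x := by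
  have h0 : algebraMap R p.ResidueField r ≠ 0 := by
    rwa [Ne, Ideal.algebraMap_residueField_eq_zero]
  exact ⟨x / algebraMap R p.ResidueField r, by rw [Algebra.smul_def, mul_div_cancel₀ _ h0]⟩

theorem Ideal.residueField_submodule_eq_top {R : Type*} [CommRing R] {p : Ideal R}
    [p.IsPrime] {U : Submodule R p.ResidueField} (hU : U ≠ ⊥)
    (hdiv : ∀ r ∉ p, ∀ x, r • x ∈ U → x ∈ U) : U = ⊤ := by
  obtain ⟨u, huU, hu0⟩ := U.ne_bot_iff.1 hU
  refine eq_top_iff.2 fun x _ => ?_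
  obtain ⟨a, b, hb, hab⟩ := p.exists_smul_residueField_eq_algebraMap (x / u)
  refine hdiv b hb x ?_
  have : b • x = a • u := by
    rw [Algebra.smul_def a, ← hab, smul_mul_assoc, div_mul_cancel₀ _ hu0]
  exact this ▸ U.smul_mem a huU

/-- The image in `κ(p)` of the localization of `R ⧸ p` at `q`. -/
def Ideal.residueFieldLocalization {R : Type*} [CommRing R] (p q : Ideal R) [p.IsPrime]
    [q.IsPrime] : Submodule R p.ResidueField where
  carrier := {x | ∃ s ∉ q, ∃ a : R, s • x = algebraMap R p.ResidueField a}
  zero_mem' := ⟨1, q.one_notMem, 0, by simp⟩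
  add_mem' := by
    rintro x y ⟨s, hs, a, ha⟩ ⟨t, ht, b, hb⟩
    refine ⟨s * t, fun h => (Ideal.IsPrime.mem_or_mem ‹_› h).elim hs ht, t * a + s * b, ?_⟩
    rw [smul_add, map_add, map_mul, map_mul, ← ha, ← hb]
    simp only [Algebra.smul_def, map_mul]
    ring
  smul_mem' := by
    rintro c x ⟨s, hs, a, ha⟩
    exact ⟨s, hs, c * a, by rw [smul_comm, ha, map_mul, Algebra.smul_def]⟩

section

variable {R : Type*} [CommRing R] {p q : Ideal R} [p.IsPrime] [q.IsPrime]

theorem Ideal.mem_residueFieldLocalization_of_smul_mem {r : R} (hr : r ∉ q) {x : p.ResidueField}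
    (hx : r • x ∈ p.residueFieldLocalization q) : x ∈ p.residueFieldLocalization q := by
  obtain ⟨s, hs, a, ha⟩ := hx
  exact ⟨s * r, fun h => (Ideal.IsPrime.mem_or_mem ‹_› h).elim hs hr, a, by rw [mul_smul, ha]⟩

theorem Ideal.residueFieldLocalization_ne_bot : p.residueFieldLocalization q ≠ ⊥ :=
  (Submodule.ne_bot_iff _).2 ⟨1, ⟨1, q.one_notMem, 1, by simp⟩, one_ne_zero⟩

theorem Ideal.residueFieldLocalization_ne_top (hpq : p < q) :
    p.residueFieldLocalization q ≠ ⊤ := by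
  intro htop
  obtain ⟨r, hrq, hrp⟩ := SetLike.exists_of_lt hpq
  obtain ⟨y, hy⟩ := Ideal.exists_smul_residueField_eq hrp (1 : p.ResidueField)
  obtain ⟨s, hs, a, ha⟩ : y ∈ p.residueFieldLocalization q := htop ▸ Submodule.mem_top
  have h : algebraMap R p.ResidueField (s - r * a) = 0 := by
    rw [map_sub, map_mul, ← ha, ← Algebra.smul_def, smul_comm, hy, Algebra.smul_def, mul_one,
      sub_self]
  rw [Ideal.algebraMap_residueField_eq_zero] at h
  exact hs ((q.sub_mem_iff_left (q.mul_mem_right a hrq)).1 (hpq.le h))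

theorem IsGabrielTopology.isSimpleGTorsionFree_residueField_iff [IsNoetherianRing R]
    {G : Set (Ideal R)} (hG : IsGabrielTopology R G) :
    IsSimpleGTorsionFree R p.ResidueField G ↔ p ∈ GStar R G := by
  constructor
  · rintro ⟨htf, -, hsimple⟩
    refine ⟨‹_›, fun hpG => one_ne_zero (htf p hpG 1 fun r hr =>
      Ideal.smul_residueField_eq_zero.2 (.inl hr)), fun q hq hpq => ?_⟩
    by_contra hqG
    refine hsimple (p.residueFieldLocalization q) Ideal.residueFieldLocalization_ne_bot
      (Ideal.residueFieldLocalization_ne_top hpq) fun a ha x hx => ?_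
    obtain ⟨r, hra, hrq⟩ := hG.exists_mem_notMem hqG ha
    induction x using Submodule.Quotient.induction_on with
    | H x =>
      have := hx r hra
      rw [← Submodule.Quotient.mk_smul, Submodule.Quotient.mk_eq_zero] at this
      exact (Submodule.Quotient.mk_eq_zero _).2
        (Ideal.mem_residueFieldLocalization_of_smul_mem hrq this)
  · rintro ⟨-, hpG, hmax⟩
    refine ⟨fun a ha x hx => ?_, ⟨1, one_ne_zero⟩, fun U hbot htop htf => htop ?_⟩
    · obtain ⟨r, hra, hrp⟩ := hG.exists_mem_notMem hpG ha
      exact (Ideal.smul_residueField_eq_zero.1 (hx r hra)).resolve_left hrp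
    · refine Ideal.residueField_submodule_eq_top hbot fun r hr x hx => ?_
      have hmem : p ⊔ Ideal.span {r} ∈ G := hG.mem_of_forall_prime_lt hmax _
        (left_lt_sup.2 (by rwa [Ideal.span_singleton_le_iff_mem]))
      rw [← Submodule.Quotient.mk_eq_zero]
      refine htf _ hmem _ fun c hc => ?_
      obtain ⟨y, hy, z, hz, rfl⟩ := Submodule.mem_sup.1 hc
      obtain ⟨d, rfl⟩ := Ideal.mem_span_singleton'.1 hz
      rw [← Submodule.Quotient.mk_smul, Submodule.Quotient.mk_eq_zero, add_smul,
        Ideal.smul_residueField_eq_zero.2 (.inl hy), zero_add, mul_smul]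
      exact U.smul_mem d hx

theorem IsGabrielTopology.isSimpleGDivisible_residueField_iff [IsNoetherianRing R]
    {G : Set (Ideal R)} (hG : IsGabrielTopology R G) :
    IsSimpleGDivisible R p.ResidueField G ↔ p ∈ GStar R G := by
  constructor
  · rintro ⟨hdiv, -, hsimple⟩
    refine ⟨‹_›, fun hpG => ?_, fun q hq hpq => ?_⟩
    · have h : p • (⊤ : Submodule R p.ResidueField) ≤ ⊥ := Submodule.smul_le.2 fun r hr x _ =>
        Ideal.smul_residueField_eq_zero.2 (.inl hr)
      rw [hdiv p hpG] at h
      exact one_ne_zero ((Submodule.mem_bot R).1 (h (Submodule.mem_top (x := 1))))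
    by_contra hqG
    refine hsimple (p.residueFieldLocalization q) Ideal.residueFieldLocalization_ne_bot
      (Ideal.residueFieldLocalization_ne_top hpq) fun a ha =>
        le_antisymm Submodule.smul_le_right fun x hx => ?_
    obtain ⟨r, hra, hrq⟩ := hG.exists_mem_notMem hqG ha
    obtain ⟨y, rfl⟩ := Ideal.exists_smul_residueField_eq (fun h => hrq (hpq.le h)) x
    exact Submodule.smul_mem_smul hra (Ideal.mem_residueFieldLocalization_of_smul_mem hrq hx)
  · rintro ⟨-, hpG, hmax⟩
    refine ⟨fun a ha => eq_top_iff.2 fun x _ => ?_, ⟨1, one_ne_zero⟩,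
      fun V hbot htop hdiv => htop ?_⟩
    · obtain ⟨r, hra, hrp⟩ := hG.exists_mem_notMem hpG ha
      obtain ⟨y, rfl⟩ := Ideal.exists_smul_residueField_eq hrp x
      exact Submodule.smul_mem_smul hra Submodule.mem_top
    · refine Ideal.residueField_submodule_eq_top hbot fun r hr x hx => ?_
      have hmem : p ⊔ Ideal.span {r} ∈ G := hG.mem_of_forall_prime_lt hmax _
        (left_lt_sup.2 (by rwa [Ideal.span_singleton_le_iff_mem]))
      have hpV : p • V = ⊥ := eq_bot_iff.2 <| Submodule.smul_le.2 fun r hr x _ =>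
        Ideal.smul_residueField_eq_zero.2 (.inl hr)
      rw [← hdiv _ hmem, Submodule.sup_smul, hpV, bot_sup_eq,
        Submodule.ideal_span_singleton_smul, Submodule.mem_smul_pointwise_iff_exists] at hx
      obtain ⟨y, hy, hyx⟩ := hx
      have : r • (y - x) = 0 := by rw [smul_sub, hyx, sub_self]
      rw [Ideal.smul_residueField_eq_zero, or_iff_right hr, sub_eq_zero] at this
      exact this ▸ hy

end

theorem stmt7 (R : Type*) [CommRing R] [IsNoetherianRing R] [IsLocalRing R]
    (G : Set (Ideal R)) (hG : IsGabrielTopology R G)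
    (p : Ideal R) [hp : p.IsPrime] :
    (IsSimpleGTorsionFree R (kappa R p) G ↔ p ∈ GStar R G) ∧
    (IsSimpleGDivisible R (kappa R p) G ↔ p ∈ GStar R G) :=
  ⟨hG.isSimpleGTorsionFree_residueField_iff, hG.isSimpleGDivisible_residueField_iff⟩
end

section
/- A cyclic R-module M is simple-𝔊-torsion-free if and only if Ann_R(M) ∈ 𝔊*. -/
theorem smul_generator_eq_zero_iff {R M : Type*} [CommRing R] [AddCommGroup M] [Module R M]
    {x : M} (hx : Submodule.span R {x} = ⊤) (r : R) :
    r • x = 0 ↔ r ∈ Module.annihilator R M := by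
  rw [Module.mem_annihilator]
  refine ⟨fun h m => ?_, fun h => h x⟩
  obtain ⟨s, rfl⟩ :=
    Submodule.mem_span_singleton.1 (hx ▸ Submodule.mem_top : m ∈ Submodule.span R {x})
  rw [smul_comm, h, smul_zero]

theorem isGTorsionFree_quotient_iff {R M : Type*} [CommRing R] [AddCommGroup M] [Module R M]
    {G : Set (Ideal R)} (U : Submodule R M) :
    IsGTorsionFree R (M ⧸ U) G ↔ ∀ a ∈ G, ∀ m : M, (∀ r ∈ a, r • m ∈ U) → m ∈ U := by
  refine forall₂_congr fun a _ => ⟨fun h m hm => ?_, fun h y hy => ?_⟩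
  · rw [← Submodule.Quotient.mk_eq_zero]
    refine h _ fun r hr => ?_
    rw [← Submodule.Quotient.mk_smul, Submodule.Quotient.mk_eq_zero]
    exact hm r hr
  · obtain ⟨m, rfl⟩ := Submodule.Quotient.mk_surjective U y
    rw [Submodule.Quotient.mk_eq_zero]
    refine h m fun r hr => ?_
    rw [← Submodule.Quotient.mk_eq_zero, Submodule.Quotient.mk_smul]
    exact hy r hr

/-- An element of `R` either kills a simple-`𝔊`-torsion-free module or acts injectively on it. -/
theorem IsSimpleGTorsionFree.mem_annihilator_of_smul_eq_zero {R M : Type*} [CommRing R]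
    [AddCommGroup M] [Module R M] {G : Set (Ideal R)} (h : IsSimpleGTorsionFree R M G)
    {r : R} {m : M} (hm : m ≠ 0) (hr : r • m = 0) : r ∈ Module.annihilator R M := by
  have hbot : LinearMap.ker (LinearMap.lsmul R M r) ≠ ⊥ :=
    (Submodule.ne_bot_iff _).2 ⟨m, by simpa using hr, hm⟩
  rw [Module.mem_annihilator]
  by_contra hne
  refine h.2.2 _ hbot (fun htop => hne fun y => ?_) ?_
  · simpa using (htop ▸ Submodule.mem_top : y ∈ LinearMap.ker (LinearMap.lsmul R M r))
  · rw [isGTorsionFree_quotient_iff]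
    intro a ha y hy
    rw [LinearMap.mem_ker, LinearMap.lsmul_apply]
    refine h.1 a ha _ fun s hs => ?_
    simpa using hy s hs

theorem IsSimpleGTorsionFree.annihilator_isPrime {R M : Type*} [CommRing R]
    [AddCommGroup M] [Module R M] {G : Set (Ideal R)} (h : IsSimpleGTorsionFree R M G) :
    (Module.annihilator R M).IsPrime := by
  obtain ⟨x, hx⟩ := h.2.1
  refine ⟨fun htop => hx ?_, fun {r s} hrs => or_iff_not_imp_right.2 fun hs => ?_⟩
  · simpa using Module.mem_annihilator.1 ((Ideal.eq_top_iff_one _).1 htop) x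
  · rw [Module.mem_annihilator] at hs
    push Not at hs
    obtain ⟨m, hm⟩ := hs
    refine h.mem_annihilator_of_smul_eq_zero hm ?_
    rw [smul_smul]
    exact Module.mem_annihilator.1 hrs m

theorem annihilator_mem_gStar_of_isSimpleGTorsionFree {R M : Type*} [CommRing R]
    [AddCommGroup M] [Module R M] {G : Set (Ideal R)}
    (hG : IsGabrielTopology R G) (h : IsSimpleGTorsionFree R M G)
    {x : M} (hx : Submodule.span R {x} = ⊤) : Module.annihilator R M ∈ GStar R G := by
  refine ⟨h.annihilator_isPrime, fun hmem => ?_, fun q hq hlt => ?_⟩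
  · obtain ⟨y, hy⟩ := h.2.1
    exact hy (h.1 _ hmem y fun r hr => Module.mem_annihilator.1 hr y)
  · by_contra hqG
    have key (r : R) : r • x ∈ Submodule.map (LinearMap.toSpanSingleton R M x) q ↔ r ∈ q := by
      refine ⟨?_, fun hr => ⟨r, hr, rfl⟩⟩
      rintro ⟨s, hs, hsr⟩
      have hz : (r - s) • x = 0 := by
        rw [sub_smul, sub_eq_zero]
        exact hsr.symm
      have := q.add_mem (hlt.le ((smul_generator_eq_zero_iff hx _).1 hz)) hs
      rwa [sub_add_cancel] at this
    obtain ⟨s, hsq, hs⟩ := Set.exists_of_ssubset hlt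
    refine h.2.2 (Submodule.map (LinearMap.toSpanSingleton R M x) q)
      ((Submodule.ne_bot_iff _).2 ⟨s • x, (key s).2 hsq,
        fun h0 => hs ((smul_generator_eq_zero_iff hx s).1 h0)⟩)
      (fun htop => hq.ne_top ((Ideal.eq_top_iff_one q).2 ((key 1).1 ?_))) ?_
    · exact htop ▸ Submodule.mem_top
    · rw [isGTorsionFree_quotient_iff]
      intro a ha m hm
      obtain ⟨t, rfl⟩ :=
        Submodule.mem_span_singleton.1 (hx ▸ Submodule.mem_top : m ∈ Submodule.span R {x})
      rw [key]
      by_contra ht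
      refine hqG (hG.2.1 a q ha fun r hr => (hq.mem_or_mem ?_).resolve_right ht)
      rw [← key, mul_smul]
      exact hm r hr

theorem isSimpleGTorsionFree_of_annihilator_mem_gStar {R M : Type*} [CommRing R]
    [IsNoetherianRing R] [AddCommGroup M] [Module R M] {G : Set (Ideal R)}
    (hG : IsGabrielTopology R G) (h : Module.annihilator R M ∈ GStar R G)
    {x : M} (hx : Submodule.span R {x} = ⊤) : IsSimpleGTorsionFree R M G := by
  obtain ⟨hp, hpG, hmax⟩ := h
  have hgen (m : M) : ∃ t : R, t • x = m :=
    Submodule.mem_span_singleton.1 (hx ▸ Submodule.mem_top)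
  refine ⟨fun a ha m hm => ?_, ⟨x, fun h0 => ?_⟩, fun U hbot htop hfree => ?_⟩
  · obtain ⟨t, rfl⟩ := hgen m
    by_contra ht
    rw [smul_generator_eq_zero_iff hx] at ht
    refine hpG (hG.2.1 a _ ha fun r hr => (hp.mem_or_mem ?_).resolve_right ht)
    rw [← smul_generator_eq_zero_iff hx, mul_smul]
    exact hm r hr
  · refine hp.ne_top ((Ideal.eq_top_iff_one _).2 ((smul_generator_eq_zero_iff hx 1).1 ?_))
    rw [h0, smul_zero]
  · have : Nontrivial (M ⧸ U) := Submodule.Quotient.nontrivial_iff.2 htop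
    obtain ⟨y, hy⟩ := exists_ne (0 : M ⧸ U)
    obtain ⟨q, hq, -⟩ := exists_le_isAssociatedPrime_of_isNoetherianRing R y hy
    obtain ⟨hqp, z, hz⟩ := isAssociatedPrime_iff.1 hq
    have hmem (r : R) : r ∈ q ↔ r • z = 0 := by
      rw [hz, Submodule.mem_colon_singleton, Submodule.mem_bot]
    obtain ⟨u, hu, hu0⟩ := (Submodule.ne_bot_iff U).1 hbot
    obtain ⟨s, rfl⟩ := hgen u
    obtain ⟨m, rfl⟩ := Submodule.Quotient.mk_surjective U z
    have hlt : Module.annihilator R M < q := by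
      refine lt_of_le_of_ne (fun r hr => ?_) fun heq => ?_
      · rw [hmem, ← Submodule.Quotient.mk_smul, Module.mem_annihilator.1 hr,
          Submodule.Quotient.mk_zero]
      · refine hu0 ((smul_generator_eq_zero_iff hx s).2 (heq ▸ (hmem s).2 ?_))
        obtain ⟨t, rfl⟩ := hgen m
        rw [← Submodule.Quotient.mk_smul, Submodule.Quotient.mk_eq_zero, smul_comm]
        exact U.smul_mem t hu
    refine hqp.ne_top ((Ideal.eq_top_iff_one q).2 ((hmem 1).2 ?_))
    rw [hfree q (hmax q hqp hlt) _ fun r hr => (hmem r).1 hr, smul_zero]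

theorem stmt9 (R : Type*) [CommRing R] [IsNoetherianRing R] [IsLocalRing R]
    (G : Set (Ideal R)) (hG : IsGabrielTopology R G)
    (M : Type*) [AddCommGroup M] [Module R M]
    (hM : ∃ x : M, Submodule.span R {x} = ⊤) :
    IsSimpleGTorsionFree R M G ↔ Module.annihilator R M ∈ GStar R G := by
  obtain ⟨x, hx⟩ := hM
  exact ⟨fun h => annihilator_mem_gStar_of_isSimpleGTorsionFree hG h hx,
    fun h => isSimpleGTorsionFree_of_annihilator_mem_gStar hG h hx⟩
end

section
/- If an R-module M is prime and uniform, then M is strongly prime, i.e. every nonzero R-endomorphism of M is injective. -/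
theorem stmt14 (R : Type*) [CommRing R] [IsNoetherianRing R] [IsLocalRing R]
    (M : Type*) [AddCommGroup M] [Module R M]
    (h1 : IsPrimeModule R M) (h2 : IsUniformModule R M) :
    ∀ f : M →ₗ[R] M, f ≠ 0 → Function.Injective f := by
  intro f hf
  rw [← LinearMap.ker_eq_bot]
  by_contra hk
  obtain ⟨y, hy⟩ : ∃ y, f y ≠ 0 := by
    by_contra! h
    exact hf (LinearMap.ext h)
  have hspan : Submodule.span R {y} ≠ ⊥ := by
    rw [Ne, Submodule.span_singleton_eq_bot]
    rintro rfl
    exact hy (map_zero f)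
  obtain ⟨z, ⟨hz, hzy⟩, hz0⟩ := Submodule.exists_mem_ne_zero_of_ne_bot (h2 _ _ hk hspan)
  obtain ⟨r, rfl⟩ := Submodule.mem_span_singleton.mp hzy
  rcases h1.2 r (f y) ((map_smul f r y).symm.trans hz) with h | h
  · exact hy h
  · exact hz0 (h y)
end

section
/- Let N be a simple-𝔊-divisible R-module that is supplemented. Then N is couniform (hollow): every proper submodule of N is superfluous, i.e. if U ⊊ N and U + X = N for a submodule X, then X = N. -/
/-- A supplement in a `𝔊`-divisible module is `𝔊`-divisible. -/
theorem IsGDivisible.smul_supplement_eq {R M : Type*} [CommRing R] [AddCommGroup M] [Module R M]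
    {G : Set (Ideal R)} (hM : IsGDivisible R M G) {U V : Submodule R M} (hUV : U ⊔ V = ⊤)
    (hmin : ∀ W : Submodule R M, W ≤ V → U ⊔ W = ⊤ → W = V) {a : Ideal R} (ha : a ∈ G) :
    a • V = V := by
  refine hmin _ Submodule.smul_le_right (top_le_iff.mp ?_)
  rw [← hM a ha, ← hUV, Submodule.smul_sup]
  exact sup_le_sup_right Submodule.smul_le_right _

theorem stmt15 (R : Type*) [CommRing R] [IsNoetherianRing R] [IsLocalRing R]
    (G : Set (Ideal R)) (hG : IsGabrielTopology R G)
    (N : Type*) [AddCommGroup N] [Module R N]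
    (hN : IsSimpleGDivisible R N G) (hsupp : IsSupplementedModule R N) :
    ∀ U : Submodule R N, U ≠ ⊤ → ∀ X : Submodule R N, U ⊔ X = ⊤ → X = ⊤ := by
  intro U hU X hX
  obtain ⟨V, hUV, hmin⟩ := hsupp U
  have hV : V = ⊤ := by
    by_contra hV
    refine hN.2.2 V ?_ hV fun a ha => hN.1.smul_supplement_eq hUV hmin ha
    rintro rfl
    exact hU (by simpa using hUV)
  subst hV
  exact hmin X le_top hX
end

section
/- Let N be a simple-𝔊-divisible R-module such that every submodule of N is supplemented. Then for every submodule V of N with N/V ≠ 0, the factor module N/V is again simple-𝔊-divisible. -/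
/-- If `f` maps a module onto an `𝔞`-divisible image, a supplement of `ker f` is `𝔞`-divisible. -/
theorem smul_supplement_ker_eq {R M P : Type*} [CommRing R] [AddCommGroup M] [Module R M]
    [AddCommGroup P] [Module R P] (f : M →ₗ[R] P) (a : Ideal R)
    (ha : a • LinearMap.range f = LinearMap.range f) (W : Submodule R M)
    (hW : LinearMap.ker f ⊔ W = ⊤)
    (hmin : ∀ W' : Submodule R M, W' ≤ W → LinearMap.ker f ⊔ W' = ⊤ → W' = W) :
    a • W = W := by
  have hmap : W.map f = LinearMap.range f := by
    rw [← Submodule.map_top, ← hW, Submodule.map_sup,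
      LinearMap.le_ker_iff_map.1 le_rfl, bot_sup_eq]
  refine hmin _ Submodule.smul_le_right ?_
  rw [sup_comm, ← Submodule.comap_map_eq, Submodule.map_smul'', hmap, ha,
    ← Submodule.map_top, Submodule.comap_map_eq, top_sup_eq]

theorem stmt17 (R : Type*) [CommRing R] [IsNoetherianRing R] [IsLocalRing R]
    (G : Set (Ideal R)) (hG : IsGabrielTopology R G)
    (N : Type*) [AddCommGroup N] [Module R N]
    (hN : IsSimpleGDivisible R N G)
    (hsupp : ∀ U : Submodule R N, IsSupplementedModule R U) :
    ∀ V : Submodule R N, V ≠ ⊤ → IsSimpleGDivisible R (N ⧸ V) G := by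
  intro V hV
  obtain ⟨hdiv, -, hsimple⟩ := hN
  refine ⟨fun a ha => ?_, ?_, fun U hbot htop hU => ?_⟩
  · rw [← V.range_mkQ, ← Submodule.map_top, ← Submodule.map_smul'', hdiv a ha]
  · have : Nontrivial (N ⧸ V) := Submodule.Quotient.nontrivial_iff.2 hV
    exact exists_ne 0
  set T : Submodule R N := U.comap V.mkQ with hT
  set f : T →ₗ[R] N ⧸ V := V.mkQ ∘ₗ T.subtype with hf
  have hrange : LinearMap.range f = U := by
    rw [hf, LinearMap.range_comp, Submodule.range_subtype, hT,
      Submodule.map_comap_eq_of_surjective V.mkQ_surjective]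
  obtain ⟨W, hW, hmin⟩ := hsupp T (LinearMap.ker f)
  refine hsimple (W.map T.subtype) (fun h => hbot ?_) (fun h => htop ?_) fun a ha => ?_
  · have hW0 : W = ⊥ :=
      Submodule.map_injective_of_injective T.injective_subtype (h.trans (Submodule.map_bot _).symm)
    rw [hW0, sup_bot_eq, LinearMap.ker_eq_top] at hW
    rw [← hrange, hW, LinearMap.range_zero]
  · have hT_top : T = ⊤ := top_le_iff.1 (h ▸ Submodule.map_subtype_le T W)
    rw [← Submodule.map_comap_eq_of_surjective V.mkQ_surjective U, ← hT, hT_top,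
      Submodule.map_top, V.range_mkQ]
  · rw [← Submodule.map_smul'',
      smul_supplement_ker_eq f a (by rw [hrange, hU a ha]) W hW hmin]
end

section
/- Let R be a commutative Noetherian local integral domain and n ≥ 0 a natural number. Then 𝔊_D = 𝔊₁ if and only if the Krull dimension of R equals n + 1. -/
theorem stmt19 (R : Type*) [CommRing R] [IsNoetherianRing R] [IsLocalRing R] [IsDomain R]
    (n : ℕ) :
    ({(⊤ : Ideal R)} ∪ {a : Ideal R | a ≠ ⊤ ∧ ringKrullDim (R ⧸ a) ≤ (n : WithBot ℕ∞)}
        = {a : Ideal R | ∃ r ∈ a, r ∈ nonZeroDivisors R}) ↔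
      ringKrullDim R = ((n + 1 : ℕ) : WithBot ℕ∞) := by
  set d := ringKrullDim R with hd
  have hbot : ringKrullDim (R ⧸ (⊥ : Ideal R)) = d :=
    ringKrullDim_eq_of_ringEquiv (RingEquiv.quotientBot R)
  have hle : ∀ e : WithBot ℕ∞, e + 1 ≤ ((n + 1 : ℕ) : WithBot ℕ∞) ↔ e ≤ (n : WithBot ℕ∞) := by
    intro e
    induction e with
    | bot => simp
    | coe e =>
      induction e with
      | top =>
        have h₁ : ¬ ((⊤ : ℕ∞) : WithBot ℕ∞) + 1 ≤ ((n + 1 : ℕ) : WithBot ℕ∞) := by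
          intro h
          have h' : (⊤ : ℕ∞) + 1 ≤ ((n + 1 : ℕ) : ℕ∞) := WithBot.coe_le_coe.mp h
          rw [top_add, top_le_iff] at h'
          exact ENat.natCast_ne_top _ h'
        have h₂ : ¬ ((⊤ : ℕ∞) : WithBot ℕ∞) ≤ (n : WithBot ℕ∞) := by
          intro h
          exact ENat.natCast_ne_top _ (top_le_iff.mp (WithBot.coe_le_coe.mp h))
        exact iff_of_false h₁ h₂
      | coe e => norm_cast; omega
  have hlt : ¬ ((n + 1 : ℕ) : WithBot ℕ∞) ≤ (n : WithBot ℕ∞) := by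
    norm_cast
    omega
  have hgt : ∀ e : WithBot ℕ∞, ¬ e ≤ (n : WithBot ℕ∞) → ((n + 1 : ℕ) : WithBot ℕ∞) ≤ e := by
    intro e
    induction e with
    | bot => simp
    | coe e =>
      induction e with
      | top => exact fun _ => by exact_mod_cast le_top
      | coe e => norm_cast; omega
  constructor
  · intro h
    have hn : ¬ d ≤ (n : WithBot ℕ∞) := by
      intro hdn
      have hmem : (⊥ : Ideal R) ∈ {a : Ideal R | ∃ r ∈ a, r ∈ nonZeroDivisors R} := by
        rw [← h]
        exact Or.inr ⟨bot_ne_top, hbot.trans_le hdn⟩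
      obtain ⟨r, hr, hr'⟩ := hmem
      exact nonZeroDivisors.ne_zero hr' (by simpa using hr)
    have hfield : ¬ IsField R := by
      intro hf
      apply hn
      rw [hd, ringKrullDim_eq_zero_of_isField hf]
      exact_mod_cast Nat.zero_le n
    obtain ⟨x, hx, hx0⟩ := Submodule.exists_mem_ne_zero_of_ne_bot
      (mt IsLocalRing.isField_iff_maximalIdeal_eq.mpr hfield)
    have hxr : x ∈ nonZeroDivisors R := mem_nonZeroDivisors_of_ne_zero hx0
    have hspan : Ideal.span {x} ∈ ({(⊤ : Ideal R)} ∪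
        {a : Ideal R | a ≠ ⊤ ∧ ringKrullDim (R ⧸ a) ≤ (n : WithBot ℕ∞)}) := by
      rw [h]
      exact ⟨x, Ideal.mem_span_singleton_self x, hxr⟩
    have hdim : ringKrullDim (R ⧸ Ideal.span {x}) ≤ (n : WithBot ℕ∞) := by
      rcases hspan with htop | ⟨-, hdim⟩
      · exact absurd (Ideal.span_singleton_eq_top.mp htop) hx
      · exact hdim
    refine le_antisymm ?_ (hgt d hn)
    rw [hd, ← ringKrullDim_quotient_span_singleton_succ_eq_ringKrullDim_of_mem_nonZeroDivisors
      hxr hx]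
    exact (hle _).mpr hdim
  · intro h
    ext a
    constructor
    · rintro (rfl | ⟨-, ha⟩)
      · exact ⟨1, trivial, one_mem _⟩
      · have ha0 : a ≠ ⊥ := by
          rintro rfl
          exact hlt (h ▸ hbot ▸ ha)
        obtain ⟨x, hx, hx0⟩ := Submodule.exists_mem_ne_zero_of_ne_bot ha0
        exact ⟨x, hx, mem_nonZeroDivisors_of_ne_zero hx0⟩
    · rintro ⟨r, hr, hr'⟩
      by_cases ha : a = ⊤
      · exact Or.inl ha
      · refine Or.inr ⟨ha, (hle _).mp ?_⟩
        rw [← h]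
        refine ringKrullDim_succ_le_of_surjective (Ideal.Quotient.mk a)
          Ideal.Quotient.mk_surjective hr' ?_
        exact Ideal.Quotient.eq_zero_iff_mem.mpr hr
end
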